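/- There exists δ > 0 such that for every complex number z with |z| < δ, one has ₃F₂(1/2, 1/2, 1/2; 1, 1; −4z/(1−z)²) = (1−z) · ( ₂F₁(1/2, 1/2; 1; z) )². -/

import Mathlib

open Complex Real

/-- The Pochhammer symbol `(a)ₖ = a(a+1)⋯(a+k−1)`. -/
noncomputable def poch (a : ℂ) (k : ℕ) : ℂ := ∏ i ∈ Finset.range k, (a + i)

/-- The generalized hypergeometric series
`ₙFₙ₋₁(a₁,…,aₙ; b₂,…,bₙ; z) = ∑ₖ (a₁)ₖ⋯(aₙ)ₖ / ((1)ₖ(b₂)ₖ⋯(bₙ)ₖ) · zᵏ`. -/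
noncomputable def hypF (upper lower : List ℂ) (z : ℂ) : ℂ :=
  ∑' k : ℕ, (upper.map fun a => poch a k).prod
    / (poch 1 k * (lower.map fun b => poch b k).prod) * z ^ k

open Filter Topology

/-- The power series `∑ kʲ cₖ xᵏ`, obtained from `∑ cₖ xᵏ` by applying `x d/dx` `j` times. -/
noncomputable def eulerSeries (c : ℕ → ℂ) (j : ℕ) (x : ℂ) : ℂ :=
  ∑' k : ℕ, (k : ℂ) ^ j * c k * x ^ k

theorem norm_eulerSeries_term_le {c : ℕ → ℂ} (hc : ∀ k, ‖c k‖ ≤ 1) (j : ℕ) {x : ℂ}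
    (hx : ‖x‖ ≤ 1 / 2) (k : ℕ) :
    ‖(k : ℂ) ^ j * c k * x ^ k‖ ≤ (k : ℝ) ^ j * (1 / 2 : ℝ) ^ k := by
  rw [norm_mul, norm_mul, norm_pow, norm_pow, Complex.norm_natCast]
  gcongr
  exact mul_le_of_le_one_right (by positivity) (hc k)

theorem summable_pow_mul_half_pow (j : ℕ) :
    Summable fun k : ℕ => (k : ℝ) ^ j * (1 / 2 : ℝ) ^ k :=
  summable_pow_mul_geometric_of_norm_lt_one j (by norm_num)

theorem summable_eulerSeries {c : ℕ → ℂ} (hc : ∀ k, ‖c k‖ ≤ 1) (j : ℕ) {x : ℂ}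
    (hx : ‖x‖ ≤ 1 / 2) : Summable fun k : ℕ => (k : ℂ) ^ j * c k * x ^ k :=
  .of_norm_bounded (summable_pow_mul_half_pow j) (norm_eulerSeries_term_le hc j hx)

theorem differentiableOn_eulerSeries {c : ℕ → ℂ} (hc : ∀ k, ‖c k‖ ≤ 1) (j : ℕ) :
    DifferentiableOn ℂ (eulerSeries c j) (Metric.ball 0 (1 / 2)) := by
  refine Complex.differentiableOn_tsum_of_summable_norm (summable_pow_mul_half_pow j)
    (fun k => by fun_prop) Metric.isOpen_ball fun k w hw => ?_
  exact norm_eulerSeries_term_le hc j (mem_ball_zero_iff.mp hw).le k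

theorem hasDerivAt_eulerSeries {c : ℕ → ℂ} (hc : ∀ k, ‖c k‖ ≤ 1) (j : ℕ) {x : ℂ}
    (hx : ‖x‖ < 1 / 2) :
    ∃ d, HasDerivAt (eulerSeries c j) d x ∧ x * d = eulerSeries c (j + 1) x := by
  have hxb : x ∈ Metric.ball (0 : ℂ) (1 / 2) := mem_ball_zero_iff.mpr hx
  refine ⟨_, ((differentiableOn_eulerSeries hc j).differentiableAt
    (Metric.isOpen_ball.mem_nhds hxb)).hasDerivAt, ?_⟩
  have h := Complex.hasSum_deriv_of_summable_norm
    (F := fun (k : ℕ) (w : ℂ) => (k : ℂ) ^ j * c k * w ^ k) (summable_pow_mul_half_pow j)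
    (fun k => by fun_prop) Metric.isOpen_ball
    (fun k w hw => norm_eulerSeries_term_le hc j (mem_ball_zero_iff.mp hw).le k) hxb
  refine ((h.mul_left x).tsum_eq.symm.trans (tsum_congr fun k => ?_))
  rw [deriv_const_mul_field, deriv_pow_field]
  rcases k with _ | k
  · simp
  · simp only [Nat.add_sub_cancel]
    ring

theorem eulerSeries_zero_right (c : ℕ → ℂ) : eulerSeries c 0 0 = c 0 := by
  rw [eulerSeries, tsum_eq_single 0 (fun k hk => by simp [hk])]
  simp

theorem eulerSeries_succ_eq {c : ℕ → ℂ} (hc : ∀ k, ‖c k‖ ≤ 1) (j : ℕ) {x : ℂ}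
    (hx : ‖x‖ ≤ 1 / 2) :
    eulerSeries c (j + 1) x = x * ∑' k : ℕ, ((k : ℂ) + 1) ^ (j + 1) * c (k + 1) * x ^ k := by
  rw [eulerSeries, (summable_eulerSeries hc (j + 1) hx).tsum_eq_zero_add, ← tsum_mul_left]
  simp only [Nat.cast_zero, ne_eq, Nat.add_eq_zero_iff, one_ne_zero, and_false, not_false_eq_true,
    zero_pow, zero_mul, zero_add]
  refine tsum_congr fun k => ?_
  push_cast
  ring

theorem eulerSeries_two_of_recurrence {c : ℕ → ℂ} (hc : ∀ k, ‖c k‖ ≤ 1)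
    (hrec : ∀ k : ℕ, ((k : ℂ) + 1) ^ 2 * c (k + 1) = ((k : ℂ) + 1 / 2) ^ 2 * c k) {x : ℂ}
    (hx : ‖x‖ ≤ 1 / 2) :
    eulerSeries c 2 x
      = x * (eulerSeries c 2 x + eulerSeries c 1 x + 1 / 4 * eulerSeries c 0 x) := by
  have hs := fun j => (summable_eulerSeries hc j hx).hasSum
  have h := ((hs 2).add (hs 1)).add ((hs 0).mul_left (1 / 4 : ℂ))
  rw [eulerSeries_succ_eq hc 1 hx]
  conv_rhs => rw [← eulerSeries_succ_eq hc 1 hx]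
  refine congrArg (x * ·) ((tsum_congr fun k => ?_).trans h.tsum_eq)
  rw [one_add_one_eq_two, hrec]
  ring

theorem eulerSeries_three_of_recurrence {c : ℕ → ℂ} (hc : ∀ k, ‖c k‖ ≤ 1)
    (hrec : ∀ k : ℕ, ((k : ℂ) + 1) ^ 3 * c (k + 1) = ((k : ℂ) + 1 / 2) ^ 3 * c k) {x : ℂ}
    (hx : ‖x‖ ≤ 1 / 2) :
    eulerSeries c 3 x
      = x * (eulerSeries c 3 x + 3 / 2 * eulerSeries c 2 x + 3 / 4 * eulerSeries c 1 x
          + 1 / 8 * eulerSeries c 0 x) := by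
  have hs := fun j => (summable_eulerSeries hc j hx).hasSum
  have h := (((hs 3).add ((hs 2).mul_left (3 / 2 : ℂ))).add ((hs 1).mul_left (3 / 4 : ℂ))).add
    ((hs 0).mul_left (1 / 8 : ℂ))
  rw [eulerSeries_succ_eq hc 2 hx]
  conv_rhs => rw [← eulerSeries_succ_eq hc 2 hx]
  refine congrArg (x * ·) ((tsum_congr fun k => ?_).trans h.tsum_eq)
  rw [show 2 + 1 = 3 from rfl, hrec]
  ring

/-- The ratio `(1/2)ₖ / (1)ₖ`. -/
noncomputable def halfRatio (k : ℕ) : ℂ := poch (1 / 2) k / poch 1 k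

theorem halfRatio_zero : halfRatio 0 = 1 := by simp [halfRatio, poch]

theorem halfRatio_succ (k : ℕ) :
    ((k : ℂ) + 1) * halfRatio (k + 1) = ((k : ℂ) + 1 / 2) * halfRatio k := by
  have hk : (k : ℂ) + 1 ≠ 0 := Nat.cast_add_one_ne_zero k
  simp only [halfRatio, poch, Finset.prod_range_succ]
  rw [mul_div_mul_comm, add_comm (1 : ℂ) k]
  field_simp
  ring

theorem norm_halfRatio_le (k : ℕ) : ‖halfRatio k‖ ≤ 1 := by
  induction k with
  | zero => simp [halfRatio_zero]
  | succ k ih =>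
    have h := congrArg norm (halfRatio_succ k)
    have h1 : ‖(k : ℂ) + 1‖ = k + 1 := by
      exact_mod_cast Complex.norm_natCast (k + 1)
    have h2 : ‖(k : ℂ) + 1 / 2‖ ≤ k + 1 := by
      refine (norm_add_le _ _).trans ?_
      rw [Complex.norm_natCast]
      norm_num
    rw [norm_mul, norm_mul, h1] at h
    have hk : (0 : ℝ) < k + 1 := by positivity
    refine le_of_mul_le_mul_left ?_ hk
    rw [h]
    exact mul_le_mul h2 ih (norm_nonneg _) hk.le

theorem hypF_two_one_eq (z : ℂ) :
    hypF [1 / 2, 1 / 2] [1] z = eulerSeries (fun k => halfRatio k ^ 2) 0 z := by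
  refine tsum_congr fun k => ?_
  simp only [halfRatio, List.map_cons, List.map_nil, List.prod_cons, List.prod_nil]
  ring

theorem hypF_three_two_eq (x : ℂ) :
    hypF [1 / 2, 1 / 2, 1 / 2] [1, 1] x = eulerSeries (fun k => halfRatio k ^ 3) 0 x := by
  refine tsum_congr fun k => ?_
  simp only [halfRatio, List.map_cons, List.map_nil, List.prod_cons, List.prod_nil]
  ring

/-- If `z D' = q E` near `0` with `q 0 = 1` and `D` is `zᵐ u`, then `E` is `zᵐ v` with
`v 0 = m u 0`. -/
theorem eventually_eq_pow_mul_of_eulerDeriv {D E q u : ℂ → ℂ} {m : ℕ} (hu : AnalyticAt ℂ u 0)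
    (hq : AnalyticAt ℂ q 0) (hq0 : q 0 = 1) (hD : ∀ᶠ z in 𝓝 0, D z = z ^ m * u z)
    (hE : ∀ᶠ z in 𝓝 0, ∃ d, HasDerivAt D d z ∧ z * d = q z * E z) :
    ∃ v, AnalyticAt ℂ v 0 ∧ v 0 = m * u 0 ∧ ∀ᶠ z in 𝓝 0, E z = z ^ m * v z := by
  have hq1 : q 0 ≠ 0 := by simp [hq0]
  refine ⟨fun z => (m * u z + z * deriv u z) / q z, ?_, by simp [hq0], ?_⟩
  · exact ((analyticAt_const.mul hu).add (analyticAt_id.mul hu.deriv)).div hq hq1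
  · filter_upwards [hD.eventually_nhds, hE, hq.continuousAt.eventually_ne hq1,
      hu.eventually_analyticAt] with z hDz hEz hqz huz
    obtain ⟨d, hd, hzd⟩ := hEz
    have hd' : HasDerivAt D (m * z ^ (m - 1) * u z + z ^ m * deriv u z) z :=
      ((hasDerivAt_pow m z).mul huz.differentiableAt.hasDerivAt).congr_of_eventuallyEq hDz
    rw [hd.unique hd'] at hzd
    have hm : z * (m * z ^ (m - 1)) = m * z ^ m := by
      rcases m with _ | m
      · simp
      · simp only [Nat.add_sub_cancel]
        ring
    rw [← mul_div_assoc, eq_div_iff hqz]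
    linear_combination -hzd + u z * hm

/-- Uniqueness of the analytic solution at a regular singular point with triple exponent `0`. -/
theorem eventually_eq_zero_of_third_order {D₀ D₁ D₂ D₃ q x : ℂ → ℂ} (hD : AnalyticAt ℂ D₀ 0)
    (hq : AnalyticAt ℂ q 0) (hq0 : q 0 = 1) (hx : ContinuousAt x 0) (hx0 : x 0 = 0)
    (h₀ : ∀ᶠ z in 𝓝 0, ∃ d, HasDerivAt D₀ d z ∧ z * d = q z * D₁ z)
    (h₁ : ∀ᶠ z in 𝓝 0, ∃ d, HasDerivAt D₁ d z ∧ z * d = q z * D₂ z)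
    (h₂ : ∀ᶠ z in 𝓝 0, ∃ d, HasDerivAt D₂ d z ∧ z * d = q z * D₃ z)
    (h₃ : ∀ᶠ z in 𝓝 0,
      D₃ z = x z * (D₃ z + 3 / 2 * D₂ z + 3 / 4 * D₁ z + 1 / 8 * D₀ z))
    (hD0 : D₀ 0 = 0) : ∀ᶠ z in 𝓝 0, D₀ z = 0 := by
  by_contra hne
  obtain ⟨m, u, hu, hu0, hDu⟩ := hD.exists_eventuallyEq_pow_smul_nonzero_iff.mpr hne
  simp only [sub_zero, smul_eq_mul] at hDu
  have hm : m ≠ 0 := by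
    rintro rfl
    have := hDu.self_of_nhds
    rw [hD0] at this
    exact hu0 (by simpa using this.symm)
  obtain ⟨u₁, hu₁, hu₁0, e₁⟩ := eventually_eq_pow_mul_of_eulerDeriv hu hq hq0 hDu h₀
  obtain ⟨u₂, hu₂, hu₂0, e₂⟩ := eventually_eq_pow_mul_of_eulerDeriv hu₁ hq hq0 e₁ h₁
  obtain ⟨u₃, hu₃, hu₃0, e₃⟩ := eventually_eq_pow_mul_of_eulerDeriv hu₂ hq hq0 e₂ h₂
  set w : ℂ → ℂ := fun z =>
    u₃ z - x z * (u₃ z + 3 / 2 * u₂ z + 3 / 4 * u₁ z + 1 / 8 * u z) with hw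
  have hwc : ContinuousAt w 0 := by
    have := hu.continuousAt
    have := hu₁.continuousAt
    have := hu₂.continuousAt
    have := hu₃.continuousAt
    fun_prop
  have hw0 : ∀ᶠ z in 𝓝[≠] (0 : ℂ), w z = 0 := by
    filter_upwards [self_mem_nhdsWithin, nhdsWithin_le_nhds hDu, nhdsWithin_le_nhds e₁,
      nhdsWithin_le_nhds e₂, nhdsWithin_le_nhds e₃, nhdsWithin_le_nhds h₃] with z hz f₀ f₁ f₂ f₃ f
    rw [f₀, f₁, f₂, f₃] at f
    refine (mul_eq_zero.mp (?_ : z ^ m * w z = 0)).resolve_left (pow_ne_zero m hz)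
    rw [hw]
    linear_combination f
  have hlim : w 0 = 0 :=
    tendsto_nhds_unique (hwc.tendsto.mono_left nhdsWithin_le_nhds)
      (tendsto_const_nhds.congr' (hw0.mono fun z hz => hz.symm))
  simp [hw, hx0, hu₃0, hu₂0, hu₁0, hm, hu0] at hlim

/-- Euler derivative of a quadratic form in `K` and `θK`, where `θ²K = z/(1-z) (θK + K/4)`. -/
theorem hasDerivAt_quadratic {K L a b c : ℂ → ℂ} {z k l a' b' c' : ℂ}
    (hK : HasDerivAt K k z) (hL : HasDerivAt L l z) (hk : z * k = L z)
    (hl : z * l = z / (1 - z) * (L z + 1 / 4 * K z))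
    (ha : HasDerivAt a a' z) (hb : HasDerivAt b b' z) (hc : HasDerivAt c c' z) :
    ∃ d, HasDerivAt (fun w => a w * K w ^ 2 + b w * (K w * L w) + c w * L w ^ 2) d z ∧
      z * d = (z * a' + b z * (z / (1 - z)) / 4) * K z ^ 2
        + (2 * a z + z * b' + b z * (z / (1 - z)) + c z * (z / (1 - z)) / 2) * (K z * L z)
        + (b z + z * c' + 2 * c z * (z / (1 - z))) * L z ^ 2 := by
  refine ⟨_, ((ha.mul (hK.pow 2)).add (hb.mul (hK.mul hL))).add (hc.mul (hL.pow 2)), ?_⟩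
  simp only [Pi.pow_apply, Pi.mul_apply]
  push_cast
  linear_combination (2 * a z * K z + b z * L z) * hk + (b z * K z + 2 * c z * L z) * hl

theorem one_sub_ne_zero_and_one_add_ne_zero {z : ℂ} (hz : ‖z‖ < 1) : 1 - z ≠ 0 ∧ 1 + z ≠ 0 := by
  constructor
  · intro h
    rw [← sub_eq_zero.mp h] at hz
    simp at hz
  · intro h
    rw [← neg_eq_of_add_eq_zero_right h] at hz
    simp at hz

/-- Near `z = 0`:
`₃F₂(1/2,1/2,1/2; 1,1; −4z/(1−z)²) = (1−z) · ₂F₁(1/2,1/2;1;z)²`. -/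
theorem statement11 : ∃ δ > (0 : ℝ), ∀ z : ℂ, ‖z‖ < δ →
    hypF [1/2, 1/2, 1/2] [1, 1] (-4 * z / (1 - z) ^ 2)
      = (1 - z) * hypF [1/2, 1/2] [1] z ^ 2 := by
  have hc2 : ∀ k, ‖halfRatio k ^ 2‖ ≤ 1 := fun k => by
    rw [norm_pow]; exact pow_le_one₀ (norm_nonneg _) (norm_halfRatio_le k)
  have hc3 : ∀ k, ‖halfRatio k ^ 3‖ ≤ 1 := fun k => by
    rw [norm_pow]; exact pow_le_one₀ (norm_nonneg _) (norm_halfRatio_le k)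
  have hrec2 : ∀ k : ℕ, ((k : ℂ) + 1) ^ 2 * halfRatio (k + 1) ^ 2
      = ((k : ℂ) + 1 / 2) ^ 2 * halfRatio k ^ 2 := fun k => by
    rw [← mul_pow, ← mul_pow, halfRatio_succ]
  have hrec3 : ∀ k : ℕ, ((k : ℂ) + 1) ^ 3 * halfRatio (k + 1) ^ 3
      = ((k : ℂ) + 1 / 2) ^ 3 * halfRatio k ^ 3 := fun k => by
    rw [← mul_pow, ← mul_pow, halfRatio_succ]
  set K : ℕ → ℂ → ℂ := eulerSeries fun k => halfRatio k ^ 2 with hK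
  set F : ℕ → ℂ → ℂ := eulerSeries fun k => halfRatio k ^ 3 with hF
  set x : ℂ → ℂ := fun z => -4 * z / (1 - z) ^ 2 with hx
  set q : ℂ → ℂ := fun z => (1 + z) / (1 - z) with hq
  have hxan : AnalyticAt ℂ x 0 := by
    refine AnalyticAt.div (by fun_prop) (by fun_prop) (by simp)
  have hqan : AnalyticAt ℂ q 0 := by
    refine AnalyticAt.div (by fun_prop) (by fun_prop) (by simp)
  have hx0 : x 0 = 0 := by simp [hx]
  have hq0 : q 0 = 1 := by simp [hq]
  have hsmall : ∀ᶠ z : ℂ in 𝓝 0, ‖z‖ < 1 / 2 := by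
    filter_upwards [Metric.ball_mem_nhds (0 : ℂ) (by norm_num : (0 : ℝ) < 1 / 2)] with z hz
    exact mem_ball_zero_iff.mp hz
  have hxsmall : ∀ᶠ z : ℂ in 𝓝 0, ‖x z‖ < 1 / 2 := by
    have := hxan.continuousAt.tendsto
    rw [hx0] at this
    exact this.eventually hsmall
  have hKan : AnalyticAt ℂ (K 0) 0 := (differentiableOn_eulerSeries hc2 0).analyticAt
    (Metric.ball_mem_nhds _ (by norm_num))
  have hFan : AnalyticAt ℂ (F 0) (x 0) := by
    rw [hx0]
    exact (differentiableOn_eulerSeries hc3 0).analyticAt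
      (Metric.ball_mem_nhds _ (by norm_num))
  have hFx : ∀ j, ∀ᶠ z in 𝓝 0, ∃ d, HasDerivAt (fun w => F j (x w)) d z ∧
      z * d = q z * F (j + 1) (x z) := by
    intro j
    filter_upwards [hsmall, hxsmall] with z hz hxz
    obtain ⟨hs, hp⟩ := one_sub_ne_zero_and_one_add_ne_zero (hz.trans (by norm_num))
    obtain ⟨d, hd, hd'⟩ := hasDerivAt_eulerSeries hc3 j hxz
    have hdx : HasDerivAt x (-4 * (1 + z) / (1 - z) ^ 3) z := by
      have := (((hasDerivAt_id z).const_mul (-4)).div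
        (((hasDerivAt_id z).const_sub 1).pow 2) (pow_ne_zero 2 hs))
      refine this.congr_deriv ?_
      simp only [id, Pi.pow_apply]
      push_cast
      field_simp
      ring
    refine ⟨_, hd.comp z hdx, ?_⟩
    rw [hF, ← hd', hx, hq]
    field_simp
  set quad : (ℂ → ℂ) → (ℂ → ℂ) → (ℂ → ℂ) → ℂ → ℂ := fun a b c w =>
    a w * K 0 w ^ 2 + b w * (K 0 w * K 1 w) + c w * K 1 w ^ 2 with hquad
  have hstep : ∀ {a b c a' b' c' E : ℂ → ℂ},
      (∀ z, ‖z‖ < 1 / 2 → HasDerivAt a (a' z) z) → (∀ z, ‖z‖ < 1 / 2 → HasDerivAt b (b' z) z) →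
      (∀ z, ‖z‖ < 1 / 2 → HasDerivAt c (c' z) z) →
      (∀ z, 1 - z ≠ 0 → 1 + z ≠ 0 →
        (z * a' z + b z * (z / (1 - z)) / 4) * K 0 z ^ 2
        + (2 * a z + z * b' z + b z * (z / (1 - z)) + c z * (z / (1 - z)) / 2) * (K 0 z * K 1 z)
        + (b z + z * c' z + 2 * c z * (z / (1 - z))) * K 1 z ^ 2 = q z * E z) →
      ∀ᶠ z in 𝓝 0, ∃ d, HasDerivAt (quad a b c) d z ∧ z * d = q z * E z := by
    intro a b c a' b' c' E ha hb hc hE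
    filter_upwards [hsmall] with z hz
    obtain ⟨hs, hp⟩ := one_sub_ne_zero_and_one_add_ne_zero (hz.trans (by norm_num))
    obtain ⟨k, hk, hk'⟩ := hasDerivAt_eulerSeries hc2 0 hz
    obtain ⟨l, hl, hl'⟩ := hasDerivAt_eulerSeries hc2 1 hz
    have hode := eulerSeries_two_of_recurrence hc2 hrec2 hz.le
    have hl'' : z * l = z / (1 - z) * (K 1 z + 1 / 4 * K 0 z) := by
      rw [hl', div_mul_eq_mul_div, eq_div_iff hs]
      linear_combination hode
    obtain ⟨d, hd, hd'⟩ := hasDerivAt_quadratic hk hl hk' hl'' (ha z hz) (hb z hz) (hc z hz)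
    exact ⟨d, hd, hd'.trans (hE z hs hp)⟩
  set H₀ : ℂ → ℂ := quad (fun z => 1 - z) (fun _ => 0) (fun _ => 0) with hH₀
  set H₁ : ℂ → ℂ := quad (fun z => -z * (1 - z) / (1 + z)) (fun z => 2 * (1 - z) ^ 2 / (1 + z))
    (fun _ => 0) with hH₁
  set H₂ : ℂ → ℂ := quad (fun z => z * (1 - z) * (-1 + 4 * z + z ^ 2) / (2 * (1 + z) ^ 3))
    (fun z => -2 * z * (1 - z) ^ 2 * (3 + z) / (1 + z) ^ 3)
    (fun z => 2 * (1 - z) ^ 3 / (1 + z) ^ 2) with hH₂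
  set H₃ : ℂ → ℂ := fun z =>
    -4 * z / (1 + z) ^ 2 * (3 / 2 * H₂ z + 3 / 4 * H₁ z + 1 / 8 * H₀ z) with hH₃
  have s₀ : ∀ᶠ z in 𝓝 0, ∃ d, HasDerivAt H₀ d z ∧ z * d = q z * H₁ z := by
    refine hstep (a' := fun _ => -1) (b' := fun _ => 0) (c' := fun _ => 0)
      (fun z _ => by simpa using (hasDerivAt_id z).const_sub 1)
      (fun z _ => hasDerivAt_const z 0) (fun z _ => hasDerivAt_const z 0) fun z hs hp => ?_
    simp only [hH₁, hquad, hq]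
    field_simp
    ring
  have s₁ : ∀ᶠ z in 𝓝 0, ∃ d, HasDerivAt H₁ d z ∧ z * d = q z * H₂ z := by
    refine hstep (a' := fun z => -(1 - 2 * z - z ^ 2) / (1 + z) ^ 2)
      (b' := fun z => -2 * (1 - z) * (3 + z) / (1 + z) ^ 2) (c' := fun _ => 0)
      (fun z hz => ?_) (fun z hz => ?_) (fun z _ => hasDerivAt_const z 0) fun z hs hp => ?_
    · obtain ⟨-, hp⟩ := one_sub_ne_zero_and_one_add_ne_zero (hz.trans (by norm_num))
      have i := hasDerivAt_id' z
      refine ((i.fun_neg.fun_mul (i.const_sub 1)).fun_div (i.const_add 1) hp).congr_deriv ?_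
      field_simp
      ring
    · obtain ⟨-, hp⟩ := one_sub_ne_zero_and_one_add_ne_zero (hz.trans (by norm_num))
      have i := hasDerivAt_id' z
      refine ((((i.const_sub 1).fun_pow 2).const_mul 2).fun_div (i.const_add 1) hp).congr_deriv ?_
      field_simp
      ring
    · simp only [hH₂, hquad, hq]
      field_simp
      ring
  have s₂ : ∀ᶠ z in 𝓝 0, ∃ d, HasDerivAt H₂ d z ∧ z * d = q z * H₃ z := by
    refine hstep
      (a' := fun z => (((1 - 2 * z) * (-1 + 4 * z + z ^ 2) + z * (1 - z) * (4 + 2 * z)) * (1 + z)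
        - 3 * (z * (1 - z) * (-1 + 4 * z + z ^ 2))) / (2 * (1 + z) ^ 4))
      (b' := fun z => -2 * (((1 - z) ^ 2 * (3 + z) - 2 * z * (1 - z) * (3 + z)
        + z * (1 - z) ^ 2) * (1 + z) - 3 * (z * (1 - z) ^ 2 * (3 + z))) / (1 + z) ^ 4)
      (c' := fun z => (-6 * (1 - z) ^ 2 * (1 + z) - 4 * (1 - z) ^ 3) / (1 + z) ^ 3)
      (fun z hz => ?_) (fun z hz => ?_) (fun z hz => ?_) fun z hs hp => ?_
    · obtain ⟨-, hp⟩ := one_sub_ne_zero_and_one_add_ne_zero (hz.trans (by norm_num))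
      have i := hasDerivAt_id' z
      refine (((i.fun_mul (i.const_sub 1)).fun_mul
        (((i.const_mul 4).const_add (-1)).fun_add (i.fun_pow 2))).fun_div
        (((i.const_add 1).fun_pow 3).const_mul 2)
        (mul_ne_zero two_ne_zero (pow_ne_zero 3 hp))).congr_deriv ?_
      push_cast
      field_simp
      ring
    · obtain ⟨-, hp⟩ := one_sub_ne_zero_and_one_add_ne_zero (hz.trans (by norm_num))
      have i := hasDerivAt_id' z
      refine ((((i.const_mul (-2)).fun_mul ((i.const_sub 1).fun_pow 2)).fun_mul
        (i.const_add 3)).fun_div ((i.const_add 1).fun_pow 3) (pow_ne_zero 3 hp)).congr_deriv ?_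
      push_cast
      field_simp
      ring
    · obtain ⟨-, hp⟩ := one_sub_ne_zero_and_one_add_ne_zero (hz.trans (by norm_num))
      have i := hasDerivAt_id' z
      refine ((((i.const_sub 1).fun_pow 3).const_mul 2).fun_div ((i.const_add 1).fun_pow 2)
        (pow_ne_zero 2 hp)).congr_deriv ?_
      push_cast
      field_simp
      ring
    · simp only [hH₃, hH₂, hH₁, hH₀, hquad, hq]
      field_simp
      ring
  have key := eventually_eq_zero_of_third_order
    (D₀ := fun z => F 0 (x z) - H₀ z) (D₁ := fun z => F 1 (x z) - H₁ z)
    (D₂ := fun z => F 2 (x z) - H₂ z) (D₃ := fun z => F 3 (x z) - H₃ z) (q := q) (x := x)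
    ((hFan.fun_comp hxan).sub (by simp only [hH₀, hquad, zero_mul, add_zero]; fun_prop))
    hqan hq0 hxan.continuousAt hx0 ?_ ?_ ?_ ?_ ?_
  · obtain ⟨δ, hδ, h⟩ := Metric.eventually_nhds_iff.mp key
    refine ⟨δ, hδ, fun z hz => ?_⟩
    have := sub_eq_zero.mp (h (by simpa using hz : dist z 0 < δ))
    rw [hypF_three_two_eq, hypF_two_one_eq]
    refine this.trans ?_
    simp [hH₀, hquad, hK]
  · filter_upwards [hFx 0, s₀] with z ⟨d, hd, e⟩ ⟨d', hd', e'⟩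
    exact ⟨d - d', hd.sub hd', by linear_combination e - e'⟩
  · filter_upwards [hFx 1, s₁] with z ⟨d, hd, e⟩ ⟨d', hd', e'⟩
    exact ⟨d - d', hd.sub hd', by linear_combination e - e'⟩
  · filter_upwards [hFx 2, s₂] with z ⟨d, hd, e⟩ ⟨d', hd', e'⟩
    exact ⟨d - d', hd.sub hd', by linear_combination e - e'⟩
  · filter_upwards [hsmall, hxsmall] with z hz hxz
    obtain ⟨hs, hp⟩ := one_sub_ne_zero_and_one_add_ne_zero (hz.trans (by norm_num))
    have e := eulerSeries_three_of_recurrence hc3 hrec3 hxz.le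
    have e' : H₃ z = x z * (H₃ z + 3 / 2 * H₂ z + 3 / 4 * H₁ z + 1 / 8 * H₀ z) := by
      simp only [hH₃, hx]
      field_simp
      ring
    linear_combination e - e'
  · simp [hH₀, hquad, hx0, hK, hF, eulerSeries_zero_right, halfRatio_zero]
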